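/- arXiv:1804.03171 — 3 statements merged into one kernel-verified Lean document; each statement's English description precedes it below -/
import Mathlib

section
/- Suppose u solves the direct problem with reaction coefficient c satisfying c(x) ≥ 0 for all x ∈ Ω, and f satisfies condition (7). Then the final-time value is strictly positive: u(x,T) > 0 for all x ∈ Ω. -/
open RealInnerProductSpace

noncomputable section

/-- The plane `ℝ²`. -/
abbrev E2 : Type := EuclideanSpace ℝ (Fin 2)

/-- The elliptic operator `(A v)(x) = - div (k(x) grad v(x))`. -/
def ellOp (k : E2 → ℝ) (v : E2 → ℝ) (x : E2) : ℝ :=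
  - ∑ i : Fin 2, fderiv ℝ (fun y => k y • gradient v y) x (EuclideanSpace.single i 1) i

/-- `u` solves the direct problem on `Ω × (0,T]` with diffusion coefficient `k`,
Robin boundary coefficient `μ`, reaction coefficient `c` and right-hand side `f`:
the parabolic equation, the homogeneous initial condition and the homogeneous
Robin (third-kind) boundary condition with respect to any outward unit normal. -/
structure IsDirectSolution (Ω : Set E2) (T : ℝ) (k μ : E2 → ℝ)
    (c : E2 → ℝ) (f : E2 → ℝ → ℝ) (u : E2 → ℝ → ℝ) : Prop where
  pde : ∀ x ∈ Ω, ∀ t : ℝ, 0 < t → t ≤ T →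
    deriv (u x) t + ellOp k (fun y => u y t) x + c x * u x t = f x t
  ic : ∀ x ∈ Ω, u x 0 = 0
  robin : ∀ x ∈ frontier Ω, ∀ ν : E2, ‖ν‖ = 1 →
    (∀ y ∈ closure Ω, (inner ℝ ν (y - x) : ℝ) ≤ 0) →
    ∀ t : ℝ, 0 < t → t ≤ T →
      k x * fderiv ℝ (fun y => u y t) x ν + μ x * u x t = 0

lemma ftp_ellOp_eq (k v : E2 → ℝ) (x : E2) (hk : DifferentiableAt ℝ k x)
    (hv : ContDiff ℝ (⊤ : ℕ∞) v) :
    ellOp k v x = - ∑ i : Fin 2,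
      (k x * fderiv ℝ (fun y => fderiv ℝ v y (EuclideanSpace.single i 1)) x
          (EuclideanSpace.single i 1)
        + fderiv ℝ v x (EuclideanSpace.single i 1) * fderiv ℝ k x (EuclideanSpace.single i 1)) := by
  have hfd : ContDiff ℝ 1 (fderiv ℝ v) := hv.fderiv_right (by norm_cast)
  have hg : Differentiable ℝ (gradient v) := by
    have : gradient v = fun y => (InnerProductSpace.toDual ℝ E2).symm (fderiv ℝ v y) := rfl
    rw [this]
    exact ((InnerProductSpace.toDual ℝ E2).symm.toContinuousLinearEquiv.differentiable).comp
      (hfd.differentiable one_ne_zero)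
  unfold ellOp
  congr 1
  refine Finset.sum_congr rfl fun i _ => ?_
  have hcoord : ∀ y, gradient v y i = fderiv ℝ v y (EuclideanSpace.single i 1) := by
    intro y
    have h1 : (inner ℝ (gradient v y) (EuclideanSpace.single i (1:ℝ)) : ℝ)
        = fderiv ℝ v y (EuclideanSpace.single i 1) := by
      simp [gradient]
    rw [← h1, EuclideanSpace.inner_single_right]; simp
  have hF : DifferentiableAt ℝ (fun y => k y • gradient v y) x := hk.smul (hg x)
  have h2 : HasFDerivAt (fun y => (k y • gradient v y) i)
      ((EuclideanSpace.proj i : E2 →L[ℝ] ℝ).comp (fderiv ℝ (fun y => k y • gradient v y) x)) x :=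
    (EuclideanSpace.proj i : E2 →L[ℝ] ℝ).hasFDerivAt.comp x hF.hasFDerivAt
  have hD : DifferentiableAt ℝ (fun y => fderiv ℝ v y (EuclideanSpace.single i 1)) x :=
    ((hfd.differentiable one_ne_zero) x).clm_apply (differentiableAt_const _)
  have h3 := hk.hasFDerivAt.mul hD.hasFDerivAt
  have h4 : (fun y => (k y • gradient v y) i)
      = (k * fun y => fderiv ℝ v y (EuclideanSpace.single i 1)) := by
    funext y; simp [hcoord]
  rw [h4] at h2
  have h5 := congrArg (fun L : E2 →L[ℝ] ℝ => L (EuclideanSpace.single i 1)) (h2.unique h3)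
  simpa using h5

lemma ftp_second (g : ℝ → ℝ) (hg : Differentiable ℝ g) (h : IsLocalMin g 0) :
    0 ≤ deriv (deriv g) 0 := by
  by_contra hneg
  push Not at hneg
  have h0 : deriv g 0 = 0 := h.deriv_eq_zero
  have hmax := isLocalMax_of_deriv_deriv_neg hneg h0 hg.continuous.continuousAt
  have hc : g =ᶠ[nhds 0] fun _ => g 0 := by
    filter_upwards [h, hmax] with s h1 h2 using le_antisymm h2 h1
  have := hc.deriv.deriv_eq
  simp at this
  linarith

/-- derivative of the perturbed slice along a line -/
lemma ftp_line (v : E2 → ℝ) (hv : ContDiff ℝ (⊤ : ℕ∞) v) (p x e : E2) (ε C s : ℝ) :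
    HasDerivAt (fun s : ℝ => v (x + s • e) + ε * (‖x + s • e - p‖ ^ 2 + C))
      (fderiv ℝ v (x + s • e) e + ε * (2 * inner ℝ (x + s • e - p) e)) s := by
  have hl : HasDerivAt (fun s : ℝ => x + s • e) e s := by
    simpa using ((hasDerivAt_id s).smul_const e).const_add x
  have h1 := ((hv.differentiable (by simp)) (x + s • e)).hasFDerivAt.comp_hasDerivAt s hl
  have h2 := (hl.sub_const p).norm_sq
  exact h1.add ((h2.add_const C).const_mul ε)

lemma ftp_space (v : E2 → ℝ) (hv : ContDiff ℝ (⊤ : ℕ∞) v) (p x e : E2) (he : ‖e‖ = 1) (ε C : ℝ)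
    (hmin : IsLocalMin (fun y => v y + ε * (‖y - p‖ ^ 2 + C)) x) :
    fderiv ℝ v x e = - (2 * ε * inner ℝ (x - p) e) ∧
    - (2 * ε) ≤ fderiv ℝ (fun y => fderiv ℝ v y e) x e := by
  have hd := fun s => ftp_line v hv p x e ε C s
  set g : ℝ → ℝ := fun s : ℝ => v (x + s • e) + ε * (‖x + s • e - p‖ ^ 2 + C) with hg
  have hloc : IsLocalMin g 0 := by
    have hc : ContinuousAt (fun s : ℝ => x + s • e) 0 := by fun_prop
    have h0 : IsLocalMin (fun y => v y + ε * (‖y - p‖ ^ 2 + C)) ((fun s : ℝ => x + s • e) 0) := by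
      simpa using hmin
    have := hc.eventually h0
    filter_upwards [this] with s hs using hs
  have hderiv : deriv g = fun s => fderiv ℝ v (x + s • e) e + ε * (2 * inner ℝ (x + s • e - p) e) :=
    funext fun s => (hd s).deriv
  have h1 := hloc.deriv_eq_zero
  have h2 := ftp_second g (fun s => (hd s).differentiableAt) hloc
  rw [hderiv] at h1 h2
  have hfd : ContDiff ℝ 1 (fderiv ℝ v) := hv.fderiv_right (by norm_cast)
  have hD : DifferentiableAt ℝ (fun y => fderiv ℝ v y e) (x + (0:ℝ) • e) :=
    ((hfd.differentiable one_ne_zero) _).clm_apply (differentiableAt_const _)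
  have hl : HasDerivAt (fun s : ℝ => x + s • e) e 0 := by
    simpa using ((hasDerivAt_id (0:ℝ)).smul_const e).const_add x
  have h3 := hD.hasFDerivAt.comp_hasDerivAt (0:ℝ) hl
  have h4 : HasDerivAt (fun s : ℝ => (inner ℝ (x + s • e - p) e : ℝ)) (inner ℝ e e) 0 := by
    simpa using (hl.sub_const p).inner ℝ (hasDerivAt_const (0:ℝ) e)
  have h5 := (h3.add ((h4.const_mul 2).const_mul ε)).deriv
  have h6 : (0:ℝ) ≤ fderiv ℝ (fun y => fderiv ℝ v y e) (x + (0:ℝ) • e) e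
      + ε * (2 * inner ℝ e e) := by
    rw [← h5]; exact h2
  rw [real_inner_self_eq_norm_sq, he] at h6
  simp only [zero_smul, add_zero] at h1 h6
  constructor <;> linarith

lemma ftp_time (g : ℝ → ℝ) (t g' : ℝ) (ht : 0 < t) (hg : HasDerivAt g g' t)
    (h : ∀ s, 0 ≤ s → s ≤ t → g t ≤ g s) : g' ≤ 0 := by
  have hm : IsLocalMinOn g (Set.Icc 0 t) t :=
    Filter.eventually_of_mem self_mem_nhdsWithin fun s hs => h s hs.1 hs.2
  have h1 := hm.hasFDerivWithinAt_nonneg hg.hasFDerivAt.hasFDerivWithinAt (y := 0 - t)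
    (sub_mem_posTangentConeAt_of_segment_subset
      ((convex_Icc 0 t).segment_subset (by simp [ht.le]) (by simp [ht.le])))
  simp at h1
  nlinarith

/-- interior contradiction -/
lemma ftp_interior (Ω : Set E2) (hΩo : IsOpen Ω) (T : ℝ) (k μ c : E2 → ℝ) (f u : E2 → ℝ → ℝ)
    (hureg : ContDiff ℝ (⊤ : ℕ∞) (Function.uncurry u))
    (hu : IsDirectSolution Ω T k μ c f u) (hc : ∀ x ∈ Ω, 0 ≤ c x)
    (p x : E2) (t ε M : ℝ) (hx : x ∈ Ω) (ht : 0 < t) (htT : t ≤ T) (hε : 0 ≤ ε)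
    (hk : DifferentiableAt ℝ k x) (hk0 : 0 ≤ k x) (hfpos : 0 < f x t)
    (hM : 4 * k x + 2 * fderiv ℝ k x (x - p) ≤ M) (hux : u x t ≤ 0)
    (hmin : ∀ y ∈ Ω, ∀ s, 0 ≤ s → s ≤ T →
      u x t + ε * (‖x - p‖ ^ 2 + (1 + M * t)) ≤ u y s + ε * (‖y - p‖ ^ 2 + (1 + M * s))) : False := by
  have hv : ContDiff ℝ (⊤ : ℕ∞) (fun y => u y t) :=
    hureg.comp (contDiff_id.prodMk contDiff_const)
  have hvt : ContDiff ℝ (⊤ : ℕ∞) (u x) :=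
    hureg.comp (contDiff_const.prodMk contDiff_id)
  have hloc : IsLocalMin (fun y => u y t + ε * (‖y - p‖ ^ 2 + (1 + M * t))) x := by
    filter_upwards [hΩo.mem_nhds hx] with y hy using hmin y hy t ht.le htT
  have htd : deriv (u x) t + ε * M ≤ 0 := by
    have h1 : HasDerivAt (fun s => u x s + ε * (‖x - p‖ ^ 2 + (1 + M * s)))
        (deriv (u x) t + ε * (M * 1)) t :=
      ((hvt.differentiable (by simp)) t).hasDerivAt.add
        (((((hasDerivAt_id t).const_mul M).const_add 1).const_add _).const_mul ε)
    have := ftp_time _ t _ ht h1 (fun s h0 h1 => hmin x hx s h0 (h1.trans htT))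
    linarith
  have hpde := hu.pde x hx t ht htT
  rw [ftp_ellOp_eq k _ x hk hv, Fin.sum_univ_two] at hpde
  obtain ⟨a0, b0⟩ := ftp_space _ hv p x (EuclideanSpace.single 0 1) (by simp) ε _ hloc
  obtain ⟨a1, b1⟩ := ftp_space _ hv p x (EuclideanSpace.single 1 1) (by simp) ε _ hloc
  rw [a0, a1] at hpde
  have hdec : x - p = (x - p) 0 • EuclideanSpace.single 0 (1:ℝ)
      + (x - p) 1 • EuclideanSpace.single 1 (1:ℝ) := by
    ext i; fin_cases i <;> simp
  rw [hdec, map_add, map_smul, map_smul] at hM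
  simp only [EuclideanSpace.inner_single_right, smul_eq_mul] at hpde hM
  simp at hpde hM
  have h1 := mul_le_mul_of_nonneg_left b0 hk0
  have h2 := mul_le_mul_of_nonneg_left b1 hk0
  have h3 := mul_nonpos_of_nonneg_of_nonpos (hc x hx) hux
  have h4 := mul_le_mul_of_nonneg_left hM hε
  simp at h1 h2
  nlinarith

lemma ftp_normal (Ω : Set E2) (hΩo : IsOpen Ω) (hΩconv : Convex ℝ Ω) (hne : Ω.Nonempty)
    (x : E2) (hx : x ∈ frontier Ω) (G : E2 →L[ℝ] ℝ) (hG : ∀ y ∈ closure Ω, 0 ≤ G (y - x)) :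
    ∃ ν : E2, ‖ν‖ = 1 ∧ (∀ y ∈ closure Ω, (inner ℝ ν (y - x) : ℝ) ≤ 0) ∧ G ν ≤ 0 := by
  have key : ∀ L : E2 →L[ℝ] ℝ, L ≠ 0 → (∀ y ∈ closure Ω, L (y - x) ≤ 0) →
      ∃ ν : E2, ‖ν‖ = 1 ∧ (∀ y ∈ closure Ω, (inner ℝ ν (y - x) : ℝ) ≤ 0) ∧ 0 ≤ L ν := by
    intro L hL h
    set g := (InnerProductSpace.toDual ℝ E2).symm L with hg
    have hLg : ∀ z, L z = inner ℝ g z := fun z => by simp [hg]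
    have hg0 : g ≠ 0 := by
      intro h0; apply hL; ext z; rw [hLg, h0]; simp
    have hn : 0 < ‖g‖ := norm_pos_iff.2 hg0
    refine ⟨‖g‖⁻¹ • g, ?_, ?_, ?_⟩
    · rw [norm_smul, norm_inv, norm_norm, inv_mul_cancel₀ hn.ne']
    · intro y hy
      rw [real_inner_smul_left, ← hLg]
      exact mul_nonpos_of_nonneg_of_nonpos (by positivity) (h y hy)
    · rw [hLg, real_inner_smul_right, real_inner_self_eq_norm_sq]; positivity
  by_cases h0 : G = 0
  · have hxn : x ∉ Ω := by
      rw [hΩo.frontier_eq] at hx; exact hx.2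
    obtain ⟨L, hL⟩ := geometric_hahn_banach_open_point hΩconv hΩo hxn
    obtain ⟨q, hq⟩ := hne
    obtain ⟨ν, h1, h2, _⟩ := key L (by rintro rfl; simpa using hL q hq) (by
      intro y hy
      have : closure Ω ⊆ {y | L (y - x) ≤ 0} := by
        refine closure_minimal ?_ (isClosed_le (by fun_prop) continuous_const)
        intro y hy; have := hL y hy; simp; linarith
      exact this hy)
    exact ⟨ν, h1, h2, by simp [h0]⟩
  · obtain ⟨ν, h1, h2, h3⟩ := key (-G) (neg_ne_zero.2 h0) (fun y hy => by
      have := hG y hy; simpa using this)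
    exact ⟨ν, h1, h2, by simpa using h3⟩

lemma ftp_boundary (Ω : Set E2) (hΩo : IsOpen Ω) (hΩconv : Convex ℝ Ω)
    (T : ℝ) (k μ c : E2 → ℝ) (f u : E2 → ℝ → ℝ)
    (hureg : ContDiff ℝ (⊤ : ℕ∞) (Function.uncurry u))
    (hu : IsDirectSolution Ω T k μ c f u)
    (p x : E2) (t ε C : ℝ) (hp : p ∈ Ω) (hx : x ∈ frontier Ω) (ht : 0 < t) (htT : t ≤ T)
    (hε : 0 < ε) (hk0 : 0 < k x) (hμ : 0 ≤ μ x) (hux : u x t ≤ 0)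
    (hmin : ∀ y ∈ closure Ω,
      u x t + ε * (‖x - p‖ ^ 2 + C) ≤ u y t + ε * (‖y - p‖ ^ 2 + C)) : False := by
  have hv : ContDiff ℝ (⊤ : ℕ∞) (fun y => u y t) :=
    hureg.comp (contDiff_id.prodMk contDiff_const)
  set G : E2 →L[ℝ] ℝ := fderiv ℝ (fun y => u y t) x + (2 * ε) • innerSL ℝ (x - p) with hGdef
  have hG : ∀ y ∈ closure Ω, 0 ≤ G (y - x) := by
    intro y hy
    have hd := ftp_line _ hv p x (y - x) ε C 0
    have hm : IsLocalMinOn (fun s : ℝ => u (x + s • (y - x)) t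
        + ε * (‖x + s • (y - x) - p‖ ^ 2 + C)) (Set.Icc 0 1) 0 := by
      refine Filter.eventually_of_mem self_mem_nhdsWithin fun s hs => ?_
      have := hmin (x + s • (y - x))
        (hΩconv.closure.add_smul_sub_mem (frontier_subset_closure hx) hy hs)
      simpa using this
    have h1 := hm.hasFDerivWithinAt_nonneg hd.hasFDerivAt.hasFDerivWithinAt (y := 1 - 0)
      (sub_mem_posTangentConeAt_of_segment_subset
        ((convex_Icc 0 1).segment_subset (by simp) (by simp)))
    simp at h1
    simp [hGdef]
    rw [inner_sub_left] at h1
    linarith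
  obtain ⟨ν, h1, h2, h3⟩ := ftp_normal Ω hΩo hΩconv ⟨p, hp⟩ x hx G hG
  have hr := hu.robin x hx ν h1 h2 t ht htT
  have hpos : (0:ℝ) < inner ℝ (x - p) ν := by
    obtain ⟨r, hr0, hr⟩ := Metric.isOpen_iff.1 hΩo p hp
    have hmem : p + (r/2) • ν ∈ Ω := by
      apply hr
      simp [norm_smul, h1, abs_of_pos hr0]
      linarith
    have := h2 _ (subset_closure hmem)
    have e : p + (r/2) • ν - x = (r/2) • ν - (x - p) := by abel
    rw [e, inner_sub_right, real_inner_smul_right, real_inner_self_eq_norm_sq, h1,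
      real_inner_comm] at this
    linarith
  have h4 : G ν = fderiv ℝ (fun y => u y t) x ν + 2 * ε * inner ℝ (x - p) ν := by
    simp [hGdef, inner_sub_left]
  have h5 := mul_pos hε hpos
  have h6 : fderiv ℝ (fun y => u y t) x ν < 0 := by nlinarith
  have h7 := mul_neg_of_pos_of_neg hk0 h6
  have h8 := mul_nonpos_of_nonneg_of_nonpos hμ hux
  linarith

/-- If `u` solves the direct problem with nonnegative reaction coefficient `c` and the
right-hand side satisfies condition (7) (`f(x,0) = 0` and `∂f/∂t > 0`), then the
final-time value of the solution is strictly positive: `u(x,T) > 0` on `Ω`. -/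
theorem final_time_positive
    (Ω : Set E2) (hΩo : IsOpen Ω) (hΩb : Bornology.IsBounded Ω) (hΩconv : Convex ℝ Ω)
    (T : ℝ) (hT : 0 < T)
    (k μ : E2 → ℝ) (k₁ k₂ : ℝ) (hk₁ : 0 < k₁)
    (hkbd : ∀ x ∈ closure Ω, k₁ ≤ k x ∧ k x ≤ k₂)
    (hkC1 : ContDiffOn ℝ 1 k (closure Ω))
    (hμ : ∀ x ∈ frontier Ω, 0 ≤ μ x)
    (f : E2 → ℝ → ℝ) (hf : ContDiff ℝ (⊤ : ℕ∞) (Function.uncurry f))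
    (c : E2 → ℝ) (hc : ∀ x ∈ Ω, 0 ≤ c x)
    (u : E2 → ℝ → ℝ) (hureg : ContDiff ℝ (⊤ : ℕ∞) (Function.uncurry u))
    (hu : IsDirectSolution Ω T k μ c f u)
    (hf0 : ∀ x ∈ Ω, f x 0 = 0)
    (hft : ∀ x ∈ Ω, ∀ t : ℝ, 0 ≤ t → t ≤ T → 0 < deriv (f x) t) :
    ∀ x ∈ Ω, 0 < u x T := by
  intro x₀ hx₀
  set K := closure Ω with hK
  have hKc : IsCompact K := hΩb.isCompact_closure
  have hsub : Ω ⊆ K := subset_closure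
  have hkd : ∀ x ∈ Ω, DifferentiableAt ℝ k x := fun x hx =>
    (hkC1.differentiableOn one_ne_zero).differentiableAt
      (Filter.mem_of_superset (hΩo.mem_nhds hx) hsub)
  have hfpos : ∀ x ∈ Ω, ∀ t, 0 < t → t ≤ T → 0 < f x t := by
    intro x hx t ht htT
    have hfx : ContDiff ℝ (⊤ : ℕ∞) (f x) := hf.comp (contDiff_const.prodMk contDiff_id)
    have hmono : StrictMonoOn (f x) (Set.Icc 0 T) :=
      strictMonoOn_of_deriv_pos (convex_Icc 0 T) hfx.continuous.continuousOn (by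
        intro s hs
        rw [interior_Icc] at hs
        exact hft x hx s hs.1.le hs.2.le)
    have := hmono ⟨le_rfl, hT.le⟩ ⟨ht.le, htT⟩ ht
    rwa [hf0 x hx] at this
  -- bound
  obtain ⟨M, hM⟩ : ∃ M : ℝ, ∀ x ∈ Ω, 4 * k x + 2 * fderiv ℝ k x (x - x₀) ≤ M := by
    have hud : UniqueDiffOn ℝ K := uniqueDiffOn_convex hΩconv.closure
      ⟨x₀, interior_mono hsub (by rwa [hΩo.interior_eq])⟩
    have hcont : ContinuousOn (fun x => 4 * k x + 2 * fderivWithin ℝ k K x (x - x₀)) K := by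
      have h1 := hkC1.continuousOn_fderivWithin hud le_rfl
      have h2 := hkC1.continuousOn
      have h3 : ContinuousOn (fun x : E2 => x - x₀) K := by fun_prop
      exact (continuousOn_const.mul h2).add (continuousOn_const.mul (h1.clm_apply h3))
    obtain ⟨M, hM⟩ := (hKc.image_of_continuousOn hcont).bddAbove
    refine ⟨M, fun x hx => ?_⟩
    have := hM ⟨x, hsub hx, rfl⟩
    simpa only [fderivWithin_of_mem_nhds (Filter.mem_of_superset (hΩo.mem_nhds hx) hsub)] using this
  have hM' : ∀ x ∈ Ω, 4 * k x + 2 * fderiv ℝ k x (x - x₀) ≤ max M 0 :=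
    fun x hx => (hM x hx).trans (le_max_left _ _)
  have hM0 : 0 ≤ max M 0 := le_max_right _ _
  generalize max M 0 = N at hM' hM0
  have hucont : Continuous (Function.uncurry u) := hureg.continuous
  have hic : ∀ x ∈ K, u x 0 = 0 := by
    intro x hx
    have : K ⊆ {x | u x 0 = 0} := by
      refine closure_minimal (fun y hy => hu.ic y hy) (isClosed_eq ?_ continuous_const)
      exact hucont.comp (continuous_id.prodMk continuous_const)
    exact this hx
  have hweak : ∀ ε : ℝ, 0 < ε → ∀ x ∈ K, ∀ t, 0 ≤ t → t ≤ T →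
      0 ≤ u x t + ε * (‖x - x₀‖ ^ 2 + (1 + N * t)) := by
    intro ε hε
    have hcomp : IsCompact (K ×ˢ Set.Icc (0:ℝ) T) := hKc.prod isCompact_Icc
    have hwc : Continuous (fun z : E2 × ℝ => Function.uncurry u z
        + ε * (‖z.1 - x₀‖ ^ 2 + (1 + N * z.2))) := by fun_prop
    obtain ⟨⟨x, t⟩, ⟨hx, ht⟩, hmin⟩ := hcomp.exists_isMinOn
      ⟨(x₀, 0), hsub hx₀, le_rfl, hT.le⟩ hwc.continuousOn
    have hmin' : ∀ y ∈ K, ∀ s, 0 ≤ s → s ≤ T →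
        u x t + ε * (‖x - x₀‖ ^ 2 + (1 + N * t)) ≤ u y s + ε * (‖y - x₀‖ ^ 2 + (1 + N * s)) :=
      fun y hy s h0 h1 => hmin (show (y, s) ∈ K ×ˢ Set.Icc (0:ℝ) T from ⟨hy, h0, h1⟩)
    simp only at hx ht
    suffices hs : 0 ≤ u x t + ε * (‖x - x₀‖ ^ 2 + (1 + N * t)) from
      fun y hy s h0 h1 => hs.trans (hmin' y hy s h0 h1)
    by_contra hneg
    push Not at hneg
    have hpsi : 0 < ε * (‖x - x₀‖ ^ 2 + (1 + N * t)) := by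
      have := mul_nonneg hM0 ht.1
      positivity
    have hux : u x t ≤ 0 := by linarith
    have ht0 : 0 < t := by
      rcases ht.1.eq_or_lt with h | h
      · rw [← h] at hneg hpsi
        rw [hic x hx] at hneg
        linarith
      · exact h
    by_cases hxΩ : x ∈ Ω
    · exact ftp_interior Ω hΩo T k μ c f u hureg hu hc x₀ x t ε N hxΩ ht0 ht.2 hε.le (hkd x hxΩ)
        (hk₁.le.trans (hkbd x hx).1) (hfpos x hxΩ t ht0 ht.2) (hM' x hxΩ) hux
        (fun y hy s h0 h1 => hmin' y (hsub hy) s h0 h1)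
    · have hxf : x ∈ frontier Ω := by
        rw [hΩo.frontier_eq]; exact ⟨hx, hxΩ⟩
      exact ftp_boundary Ω hΩo hΩconv T k μ c f u hureg hu x₀ x t ε _ hx₀ hxf ht0 ht.2 hε
        (hk₁.trans_le (hkbd x hx).1) (hμ x hxf) hux
        (fun y hy => hmin' y hy t ht.1 ht.2)
  have hnonneg : ∀ x ∈ K, ∀ t, 0 ≤ t → t ≤ T → 0 ≤ u x t := by
    intro x hx t h0 h1
    by_contra hneg
    push Not at hneg
    have hA : 0 < ‖x - x₀‖ ^ 2 + (1 + N * t) := by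
      have := mul_nonneg hM0 h0
      positivity
    have := hweak (-(u x t) / 2 / (‖x - x₀‖ ^ 2 + (1 + N * t))) (div_pos (by linarith) hA) x hx t h0 h1
    rw [div_mul_cancel₀ _ hA.ne'] at this
    linarith
  by_contra hle
  push Not at hle
  refine ftp_interior Ω hΩo T k μ c f u hureg hu hc x₀ x₀ T 0 N hx₀ hT le_rfl le_rfl (hkd x₀ hx₀)
    (hk₁.le.trans (hkbd x₀ (hsub hx₀)).1) (hfpos x₀ hx₀ T hT le_rfl) (hM' x₀ hx₀) hle ?_
  intro y hy s h0 h1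
  have := hnonneg y (hsub hy) s h0 h1
  linarith
end
end

section
/- Suppose u solves the direct problem with reaction coefficient c satisfying c(x) ≥ 0 for all x ∈ Ω, and f satisfies condition (7). Then u(x,t) ≥ 0 for all x ∈ Ω and 0 < t ≤ T. -/
noncomputable section

theorem aux_second {h : ℝ → ℝ} {a : ℝ} (hm : IsLocalMin h a) (hc : ContinuousAt h a) :
    0 ≤ deriv (deriv h) a := by
  by_contra hneg
  push Not at hneg
  have hmax : IsLocalMax h a := isLocalMax_of_deriv_deriv_neg hneg hm.deriv_eq_zero hc
  have heq : h =ᶠ[nhds a] fun _ => h a := by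
    filter_upwards [hm, hmax] with y h1 h2
    exact le_antisymm h2 h1
  have h1 : deriv h =ᶠ[nhds a] deriv (fun _ => h a) := heq.deriv
  have h2 := h1.deriv_eq
  simp at h2
  linarith

theorem aux_grad (v : E2 → ℝ) (y : E2) (i : Fin 2) :
    (gradient v y) i = fderiv ℝ v y (EuclideanSpace.single i 1) := by
  have h1 : inner ℝ (gradient v y) (EuclideanSpace.single i (1:ℝ))
      = fderiv ℝ v y (EuclideanSpace.single i 1) := by
    simp [gradient]
  rw [← h1]
  rw [EuclideanSpace.inner_single_right]
  simp

theorem aux_line {v : E2 → ℝ} (hv : Differentiable ℝ v) (x e : E2) (s : ℝ) :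
    HasDerivAt (fun s : ℝ => v (x + s • e)) (fderiv ℝ v (x + s • e) e) s := by
  have h1 : HasDerivAt (fun s : ℝ => x + s • e) e s := by
    simpa using ((hasDerivAt_id s).smul_const e).const_add x
  exact (hv _).hasFDerivAt.comp_hasDerivAt s h1

theorem aux_ell {k v : E2 → ℝ} {x : E2} (hk : DifferentiableAt ℝ k x) (hv : ContDiff ℝ 2 v) :
    ellOp k v x = - ∑ i : Fin 2,
      (k x * deriv (deriv (fun s : ℝ => v (x + s • (EuclideanSpace.single i 1 : E2)))) 0
        + fderiv ℝ k x (EuclideanSpace.single i 1) * fderiv ℝ v x (EuclideanSpace.single i 1)) := by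
  unfold ellOp
  congr 1
  refine Finset.sum_congr rfl fun i _ => ?_
  have hdv : Differentiable ℝ v := hv.differentiable (by norm_num)
  have hf' : ContDiff ℝ 1 (fderiv ℝ v) := hv.fderiv_right (by norm_num)
  have hfd : Differentiable ℝ (fderiv ℝ v) := hf'.differentiable (by norm_num)
  have hg : Differentiable ℝ (gradient v) := by
    intro y
    exact (InnerProductSpace.toDual ℝ E2).symm.toContinuousLinearEquiv.toContinuousLinearMap.differentiableAt.comp y (hfd y)
  set e : E2 := EuclideanSpace.single i 1 with he
  have hprod : DifferentiableAt ℝ (fun y => k y • gradient v y) x := hk.smul (hg x)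
  have h1 : fderiv ℝ (fun y => k y • gradient v y) x e i
      = fderiv ℝ (fun y => (k y • gradient v y) i) x e := by
    have := ((EuclideanSpace.proj i : E2 →L[ℝ] ℝ).hasFDerivAt.comp x hprod.hasFDerivAt).fderiv
    have h2 := congrArg (fun L => L e) this
    simpa [Function.comp_def] using h2.symm
  rw [h1]
  have h2 : (fun y => (k y • gradient v y) i) = fun y => k y * fderiv ℝ v y e := by
    funext y
    simp [aux_grad, he]
  rw [h2]
  have hq : DifferentiableAt ℝ (fun y => fderiv ℝ v y e) x := (hfd x).clm_apply (differentiableAt_const e)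
  have hqd : Differentiable ℝ (fun y => fderiv ℝ v y e) := fun y => (hfd y).clm_apply (differentiableAt_const e)
  have h3 : deriv (fun s : ℝ => v (x + s • e)) = fun s => fderiv ℝ v (x + s • e) e := by
    funext s
    exact (aux_line hdv x e s).deriv
  rw [h3, (aux_line hqd x e 0).deriv, fderiv_fun_mul hk hq]
  simp
  ring

theorem aux_bd {Ω : Set E2} (hΩo : IsOpen Ω) (hΩb : Bornology.IsBounded Ω) (hΩconv : Convex ℝ Ω)
    (hne : Ω.Nonempty) {k : E2 → ℝ} (hk : ContDiffOn ℝ 1 k (closure Ω)) :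
    ∃ L : ℝ, 0 ≤ L ∧ ∀ x ∈ Ω, ‖fderiv ℝ k x‖ ≤ L := by
  have hcl : IsCompact (closure Ω) := hΩb.isCompact_closure
  have hud : UniqueDiffOn ℝ (closure Ω) := by
    apply uniqueDiffOn_convex hΩconv.closure
    exact hne.mono (interior_maximal subset_closure hΩo)
  have hcont := hk.continuousOn_fderivWithin hud (le_refl _)
  obtain ⟨L, hL⟩ := hcl.exists_bound_of_continuousOn hcont
  refine ⟨max L 0, le_max_right _ _, fun x hx => ?_⟩
  have hn : closure Ω ∈ nhds x := Filter.mem_of_superset (hΩo.mem_nhds hx) subset_closure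
  rw [← fderivWithin_of_mem_nhds hn]
  exact (hL x (subset_closure hx)).trans (le_max_left _ _)

theorem aux_psi (p x : E2) :
    HasFDerivAt (fun y : E2 => ‖y - p‖ ^ 2 / 2) (innerSL ℝ (x - p)) x := by
  have h := ((hasFDerivAt_id x).sub_const p).norm_sq
  have h2 := h.const_mul (1/2 : ℝ)
  have e1 : (fun y : E2 => ‖y - p‖ ^ 2 / 2) = fun y => (1/2 : ℝ) * ‖id y - p‖ ^ 2 := by
    funext y; simp; ring
  rw [e1]
  have e2 : innerSL ℝ (x - p) = (1/2 : ℝ) • (2 • (innerSL ℝ (id x - p)).comp (ContinuousLinearMap.id ℝ E2)) := by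
    ext z
    simp
  rw [e2]
  exact h2

theorem aux_psi2 (p x : E2) (i : Fin 2) :
    deriv (deriv (fun s : ℝ => ‖x + s • (EuclideanSpace.single i 1 : E2) - p‖ ^ 2 / 2)) 0 = 1 := by
  set e : E2 := EuclideanSpace.single i 1 with he
  have hd : Differentiable ℝ (fun y : E2 => ‖y - p‖ ^ 2 / 2) := fun y => (aux_psi p y).differentiableAt
  have h3 : deriv (fun s : ℝ => ‖x + s • e - p‖ ^ 2 / 2) = fun s : ℝ => inner ℝ (x - p) e + s * 1 := by
    funext s
    have := (aux_line hd x e s).deriv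
    rw [(aux_psi p _).fderiv] at this
    rw [this]
    have hee : inner ℝ e e = (1:ℝ) := by
      rw [real_inner_self_eq_norm_sq]; simp [he]
    simp only [innerSL_apply_apply]
    rw [add_sub_right_comm, inner_add_left, inner_smul_left, hee]
    simp
  rw [h3]
  simp

theorem aux_support {Ω : Set E2} (hΩo : IsOpen Ω) (hΩconv : Convex ℝ Ω)
    {x : E2} (hx : x ∉ Ω) (hne : Ω.Nonempty) :
    ∃ ν : E2, ‖ν‖ = 1 ∧ ∀ y ∈ closure Ω, (inner ℝ ν (y - x) : ℝ) ≤ 0 := by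
  obtain ⟨φ, hφ⟩ := geometric_hahn_banach_open_point hΩconv hΩo hx
  set w : E2 := (InnerProductSpace.toDual ℝ E2).symm φ with hw
  have hwφ : ∀ z, inner ℝ w z = φ z := fun z => by simp [hw]
  have hw0 : w ≠ 0 := by
    intro h0
    obtain ⟨y, hy⟩ := hne
    have := hφ y hy
    rw [← hwφ, ← hwφ, h0] at this
    simp at this
  have hwn : 0 < ‖w‖ := norm_pos_iff.mpr hw0
  refine ⟨‖w‖⁻¹ • w, ?_, ?_⟩
  · rw [norm_smul, norm_inv, norm_norm, inv_mul_cancel₀ hwn.ne']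
  · have hcl : closure Ω ⊆ {y | (inner ℝ (‖w‖⁻¹ • w) (y - x) : ℝ) ≤ 0} := by
      apply closure_minimal
      · intro y hy
        have := hφ y hy
        simp only [Set.mem_ofPred_eq]
        rw [real_inner_smul_left, inner_sub_right, hwφ, hwφ]
        have : 0 < ‖w‖⁻¹ := by positivity
        nlinarith
      · exact isClosed_le (by fun_prop) (by fun_prop)
    exact fun y hy => hcl hy

theorem aux_pos {Ω : Set E2} (hΩo : IsOpen Ω) {p x ν : E2} (hp : p ∈ Ω) (hν : ‖ν‖ = 1)
    (h : ∀ y ∈ closure Ω, (inner ℝ ν (y - x) : ℝ) ≤ 0) : 0 < (inner ℝ ν (x - p) : ℝ) := by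
  obtain ⟨r, hr, hb⟩ := Metric.isOpen_iff.mp hΩo p hp
  have hm : p + (r/2) • ν ∈ Ω := by
    apply hb
    simp [norm_smul, hν, abs_of_pos hr]
    linarith
  have := h _ (subset_closure hm)
  have e : p + (r/2) • ν - x = (r/2) • ν - (x - p) := by abel
  rw [e, inner_sub_right, inner_smul_right, real_inner_self_eq_norm_sq, hν] at this
  linarith

theorem aux_main
    (Ω : Set E2) (hΩo : IsOpen Ω) (hΩb : Bornology.IsBounded Ω) (hΩconv : Convex ℝ Ω)
    (T : ℝ) (hT : 0 < T)
    (k μ : E2 → ℝ) (k₁ k₂ : ℝ) (hk₁ : 0 < k₁)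
    (hkbd : ∀ x ∈ closure Ω, k₁ ≤ k x ∧ k x ≤ k₂)
    (hkC1 : ContDiffOn ℝ 1 k (closure Ω))
    (hμ : ∀ x ∈ frontier Ω, 0 ≤ μ x)
    (f : E2 → ℝ → ℝ)
    (c : E2 → ℝ) (hc : ∀ x ∈ Ω, 0 ≤ c x)
    (u : E2 → ℝ → ℝ) (hureg : ContDiff ℝ (⊤ : ℕ∞) (Function.uncurry u))
    (hu : IsDirectSolution Ω T k μ c f u)
    (hfpos : ∀ x ∈ Ω, ∀ t : ℝ, 0 < t → t ≤ T → 0 < f x t)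
    (p : E2) (hp : p ∈ Ω) :
    ∃ M : ℝ, 0 ≤ M ∧ ∀ ε : ℝ, 0 < ε → ∀ x ∈ Ω, ∀ t : ℝ, 0 ≤ t → t ≤ T →
      0 ≤ u x t + ε * (‖x - p‖ ^ 2 / 2 + M * t) := by
  obtain ⟨L, hL0, hL⟩ := aux_bd hΩo hΩb hΩconv ⟨p, hp⟩ hkC1
  obtain ⟨D, hD⟩ := hΩb.isCompact_closure.exists_bound_of_continuousOn
    (f := fun x : E2 => x - p) (by fun_prop)
  have hD0 : 0 ≤ D := (norm_nonneg _).trans (hD p (subset_closure hp))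
  have hk20 : 0 ≤ k₂ := by
    have := hkbd p (subset_closure hp); linarith
  refine ⟨2 * (L * D) + 2 * k₂, by positivity, fun ε hε => ?_⟩
  set M := 2 * (L * D) + 2 * k₂ with hM
  have hM0 : 0 ≤ M := by positivity
  have hucont : Continuous (Function.uncurry u) := hureg.continuous
  have hvcont : Continuous (fun z : E2 × ℝ => u z.1 z.2 + ε * (‖z.1 - p‖ ^ 2 / 2 + M * z.2)) := by
    have : Continuous (fun z : E2 × ℝ => u z.1 z.2) := hucont
    fun_prop
  have hcomp : IsCompact (closure Ω ×ˢ Set.Icc (0:ℝ) T) := hΩb.isCompact_closure.prod isCompact_Icc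
  obtain ⟨⟨x₀, t₀⟩, ⟨hx₀, ht₀⟩, hmin⟩ := hcomp.exists_isMinOn
    ⟨(p, 0), subset_closure hp, by simp [hT.le]⟩ hvcont.continuousOn
  have hmin' : ∀ x ∈ closure Ω, ∀ t : ℝ, 0 ≤ t → t ≤ T →
      u x₀ t₀ + ε * (‖x₀ - p‖ ^ 2 / 2 + M * t₀) ≤ u x t + ε * (‖x - p‖ ^ 2 / 2 + M * t) :=
    fun x hx t h0 h1 => hmin (show (x, t) ∈ closure Ω ×ˢ Set.Icc (0:ℝ) T from ⟨hx, h0, h1⟩)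
  simp only at hx₀ ht₀
  suffices hs : 0 ≤ u x₀ t₀ + ε * (‖x₀ - p‖ ^ 2 / 2 + M * t₀) from
    fun x hx t h0 h1 => hs.trans (hmin' x (subset_closure hx) t h0 h1)
  by_contra hneg
  push Not at hneg
  obtain ⟨ht0, htT⟩ := ht₀
  have hu0 : u x₀ t₀ < 0 := by
    have : 0 ≤ ε * (‖x₀ - p‖ ^ 2 / 2 + M * t₀) := by positivity
    linarith
  have htpos : 0 < t₀ := by
    rcases ht0.eq_or_lt with h | h
    · exfalso
      have hz : ∀ x ∈ closure Ω, u x 0 = 0 := by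
        have hcl : closure Ω ⊆ {x | u x 0 = 0} := by
          apply closure_minimal (fun x hx => hu.ic x hx)
          have hcc : Continuous (fun x => u x 0) := hucont.comp (by fun_prop : Continuous fun x : E2 => (x, (0:ℝ)))
          exact isClosed_eq hcc continuous_const
        exact fun x hx => hcl hx
      rw [← h, hz x₀ hx₀] at hu0
      exact lt_irrefl _ hu0
    · exact h
  -- regularity in space
  have hus : ContDiff ℝ 2 (fun y => u y t₀) := by
    have h1 : ContDiff ℝ 2 (Function.uncurry u) := contDiff_infty.mp hureg 2
    exact h1.comp (by fun_prop : ContDiff ℝ 2 fun x : E2 => (x, t₀))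
  have hud : Differentiable ℝ (fun y => u y t₀) := hus.differentiable (by norm_num)
  have hut : Differentiable ℝ (u x₀) := by
    have h1 : ContDiff ℝ 2 (Function.uncurry u) := contDiff_infty.mp hureg 2
    exact (h1.comp (by fun_prop : ContDiff ℝ 2 fun t : ℝ => (x₀, t))).differentiable (by norm_num)
  set G : E2 →L[ℝ] ℝ := fderiv ℝ (fun y => u y t₀) x₀ + ε • innerSL ℝ (x₀ - p) with hG
  set v : E2 → ℝ := fun y => u y t₀ + ε * (‖y - p‖ ^ 2 / 2) with hv
  have hvd : ∀ y, HasFDerivAt v (fderiv ℝ (fun y => u y t₀) y + ε • innerSL ℝ (y - p)) y :=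
    fun y => (hud y).hasFDerivAt.add ((aux_psi p y).const_mul ε)
  have hvmin : ∀ x ∈ closure Ω, v x₀ ≤ v x := by
    intro x hx
    have := hmin' x hx t₀ ht0 htT
    simp only [hv]
    nlinarith
  by_cases hxΩ : x₀ ∈ Ω
  · -- interior
    have hloc : IsLocalMin v x₀ := by
      filter_upwards [hΩo.mem_nhds hxΩ] with y hy using hvmin y (subset_closure hy)
    have hG0 : G = 0 := by
      have := hloc.fderiv_eq_zero
      rwa [(hvd x₀).fderiv] at this
    have hgu : ∀ e, fderiv ℝ (fun y => u y t₀) x₀ e = - ε * inner ℝ (x₀ - p) e := by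
      intro e
      have := congrArg (fun L => L e) hG0
      simp [hG] at this
      rw [inner_sub_left]
      linarith
    have hkd : DifferentiableAt ℝ k x₀ :=
      (hkC1.differentiableOn (by norm_num)).differentiableAt
        (Filter.mem_of_superset (hΩo.mem_nhds hxΩ) subset_closure)
    have hpde := hu.pde x₀ hxΩ t₀ htpos htT
    have hfp := hfpos x₀ hxΩ t₀ htpos htT
    have hcu : c x₀ * u x₀ t₀ ≤ 0 := mul_nonpos_of_nonneg_of_nonpos (hc x₀ hxΩ) hu0.le
    -- time derivative
    have htd : deriv (u x₀) t₀ ≤ - ε * M := by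
      have hd : HasDerivAt (fun t => u x₀ t + ε * (M * t)) (deriv (u x₀) t₀ + ε * (M * 1)) t₀ :=
        (hut t₀).hasDerivAt.add (((hasDerivAt_id t₀).const_mul M).const_mul ε)
      have hle : deriv (u x₀) t₀ + ε * (M * 1) ≤ 0 := by
        have hsl := hd.hasDerivWithinAt (s := Set.Iio t₀)
        rw [hasDerivWithinAt_iff_tendsto_slope' (by simp)] at hsl
        apply le_of_tendsto hsl
        have : Set.Ioo 0 t₀ ∈ nhdsWithin t₀ (Set.Iio t₀) := Ioo_mem_nhdsLT htpos
        filter_upwards [this] with t ht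
        rw [slope_def_field]
        have := hmin' x₀ hx₀ t ht.1.le (ht.2.le.trans htT)
        apply div_nonpos_of_nonneg_of_nonpos
        · nlinarith
        · linarith [ht.2]
      linarith
    -- second derivatives
    have hsec : ∀ i : Fin 2, -ε ≤
        deriv (deriv (fun s : ℝ => u (x₀ + s • (EuclideanSpace.single i 1 : E2)) t₀)) 0 := by
      intro i
      set e : E2 := EuclideanSpace.single i 1 with he
      have hcl : Continuous (fun s : ℝ => x₀ + s • e) := by fun_prop
      have hvc : Continuous v := continuous_iff_continuousAt.mpr fun y => (hvd y).continuousAt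
      have hlm : IsLocalMin (fun s : ℝ => v (x₀ + s • e)) 0 := by
        have ht : Filter.Tendsto (fun s : ℝ => x₀ + s • e) (nhds 0) (nhds x₀) := by
          simpa using hcl.tendsto 0
        have := ht.eventually hloc
        simpa [IsLocalMin, IsMinFilter] using this
      have h0 := aux_second hlm (hvc.comp hcl).continuousAt
      have hc1 : ContDiff ℝ 2 (fun s : ℝ => u (x₀ + s • e) t₀) :=
        hus.comp (by fun_prop : ContDiff ℝ 2 (fun s : ℝ => x₀ + s • e))
      have hc2 : ContDiff ℝ 2 (fun s : ℝ => ‖x₀ + s • e - p‖ ^ 2 / 2) := by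
        have : ContDiff ℝ 2 (fun s : ℝ => x₀ + s • e - p) := by fun_prop
        exact (this.norm_sq ℝ).div_const 2
      have hd1 := hc1.differentiable (by norm_num)
      have hd2 := hc2.differentiable (by norm_num)
      have hdd1 : Differentiable ℝ (deriv (fun s : ℝ => u (x₀ + s • e) t₀)) :=
        (contDiff_succ_iff_deriv.mp (show ContDiff ℝ (1+1) _ from by simpa [one_add_one_eq_two] using hc1)).2.2.differentiable (by norm_num)
      have hdd2 : Differentiable ℝ (deriv (fun s : ℝ => ‖x₀ + s • e - p‖ ^ 2 / 2)) :=
        (contDiff_succ_iff_deriv.mp (show ContDiff ℝ (1+1) _ from by simpa [one_add_one_eq_two] using hc2)).2.2.differentiable (by norm_num)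
      have e1 : deriv (fun s : ℝ => v (x₀ + s • e)) = fun s =>
          deriv (fun s : ℝ => u (x₀ + s • e) t₀) s + ε * deriv (fun s : ℝ => ‖x₀ + s • e - p‖ ^ 2 / 2) s := by
        funext s
        exact ((hd1 s).hasDerivAt.add ((hd2 s).hasDerivAt.const_mul ε)).deriv
      rw [e1, ((hdd1 0).hasDerivAt.fun_add ((hdd2 0).hasDerivAt.const_mul ε)).deriv,
        aux_psi2] at h0
      linarith
    have hterm : ∀ i : Fin 2, - (ε * (L * D) + ε * k₂) ≤
        k x₀ * deriv (deriv (fun s : ℝ => u (x₀ + s • (EuclideanSpace.single i 1 : E2)) t₀)) 0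
        + fderiv ℝ k x₀ (EuclideanSpace.single i 1) *
          fderiv ℝ (fun y => u y t₀) x₀ (EuclideanSpace.single i 1) := by
      intro i
      have hkx := hkbd x₀ hx₀
      have h1 := hsec i
      rw [hgu]
      set e : E2 := EuclideanSpace.single i 1 with he
      have hen : ‖e‖ = 1 := by simp [he]
      have h2 : |fderiv ℝ k x₀ e| ≤ L := by
        have := (fderiv ℝ k x₀).le_opNorm e
        rw [hen, mul_one] at this
        exact this.trans (hL x₀ hxΩ)
      have h3 : |inner ℝ (x₀ - p) e| ≤ D := by
        have := abs_real_inner_le_norm (x₀ - p) e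
        rw [hen, mul_one] at this
        exact this.trans (hD x₀ hx₀)
      have h4 : fderiv ℝ k x₀ e * inner ℝ (x₀ - p) e ≤ L * D := by
        refine (le_abs_self _).trans ?_
        rw [abs_mul]
        exact mul_le_mul h2 h3 (abs_nonneg _) hL0
      have h5 : k x₀ * (-ε) ≤ k x₀ * deriv (deriv (fun s : ℝ => u (x₀ + s • e) t₀)) 0 :=
        mul_le_mul_of_nonneg_left h1 (by linarith)
      nlinarith
    have hell := aux_ell hkd hus
    rw [hell, Fin.sum_univ_two] at hpde
    have := hterm 0
    have := hterm 1
    rw [hM] at htd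
    nlinarith
  · -- boundary
    have hfr : x₀ ∈ frontier Ω := by
      rw [hΩo.frontier_eq]; exact ⟨hx₀, hxΩ⟩
    have hpos : ∀ ν : E2, ‖ν‖ = 1 → (∀ y ∈ closure Ω, (inner ℝ ν (y - x₀) : ℝ) ≤ 0) → 0 < G ν := by
      intro ν hν hn
      have h1 := hu.robin x₀ hfr ν hν hn t₀ htpos htT
      have h2 := aux_pos hΩo hp hν hn
      have h3 : μ x₀ * u x₀ t₀ ≤ 0 := mul_nonpos_of_nonneg_of_nonpos (hμ x₀ hfr) hu0.le
      have h4 : 0 < k x₀ := hk₁.trans_le (hkbd x₀ hx₀).1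
      have h5 : 0 ≤ fderiv ℝ (fun y => u y t₀) x₀ ν := by
        by_contra hh
        push Not at hh
        nlinarith
      have h6 : G ν = fderiv ℝ (fun y => u y t₀) x₀ ν + ε * inner ℝ ν (x₀ - p) := by
        rw [real_inner_comm]; simp [hG, inner_sub_left]
      rw [h6]
      positivity
    have hdir : ∀ y ∈ closure Ω, 0 ≤ G (y - x₀) := by
      intro y hy
      have hd : HasDerivAt (fun s : ℝ => v (x₀ + s • (y - x₀))) (G (y - x₀)) 0 := by
        have := aux_line (fun z => (hvd z).differentiableAt) x₀ (y - x₀) 0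
        rw [(hvd _).fderiv] at this
        simpa [hG] using this
      have hsl := hd.hasDerivWithinAt (s := Set.Ioi 0)
      rw [hasDerivWithinAt_iff_tendsto_slope' (by simp)] at hsl
      apply ge_of_tendsto hsl
      filter_upwards [Ioo_mem_nhdsGT (zero_lt_one (α := ℝ))] with s hs
      rw [slope_def_field]
      have hm : x₀ + s • (y - x₀) ∈ closure Ω :=
        hΩconv.closure.add_smul_sub_mem hx₀ hy ⟨hs.1.le, hs.2.le⟩
      have := hvmin _ hm
      apply div_nonneg
      · simpa using this
      · linarith [hs.1]
    by_cases hG0 : G = 0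
    · obtain ⟨ν, hν, hn⟩ := aux_support hΩo hΩconv hxΩ ⟨p, hp⟩
      have := hpos ν hν hn
      rw [hG0] at this
      simp at this
    · set w : E2 := (InnerProductSpace.toDual ℝ E2).symm G with hw
      have hwG : ∀ z, inner ℝ w z = G z := fun z => by
        rw [hw, InnerProductSpace.toDual_symm_apply]
      have hw0 : w ≠ 0 := by
        intro h0
        apply hG0
        ext z
        rw [← hwG, h0]; simp
      have hwn : 0 < ‖w‖ := norm_pos_iff.mpr hw0
      have hi : 0 < ‖w‖⁻¹ := by positivity
      have := hpos (-(‖w‖⁻¹ • w))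
        (by rw [norm_neg, norm_smul, norm_inv, norm_norm, inv_mul_cancel₀ hwn.ne'])
        (fun y hy => by
          rw [inner_neg_left, real_inner_smul_left, hwG]
          have := hdir y hy
          nlinarith [mul_nonneg hi.le this])
      rw [← hwG, inner_neg_right, real_inner_smul_right, real_inner_self_eq_norm_sq] at this
      have : 0 < ‖w‖⁻¹ * ‖w‖ ^ 2 := by positivity
      linarith

/-- the solution of the direct problem with nonnegative reaction
coefficient and right-hand side satisfying condition (7) is nonnegative. -/
theorem solution_nonneg
    (Ω : Set E2) (hΩo : IsOpen Ω) (hΩb : Bornology.IsBounded Ω) (hΩconv : Convex ℝ Ω)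
    (T : ℝ) (hT : 0 < T)
    (k μ : E2 → ℝ) (k₁ k₂ : ℝ) (hk₁ : 0 < k₁)
    (hkbd : ∀ x ∈ closure Ω, k₁ ≤ k x ∧ k x ≤ k₂)
    (hkC1 : ContDiffOn ℝ 1 k (closure Ω))
    (hμ : ∀ x ∈ frontier Ω, 0 ≤ μ x)
    (f : E2 → ℝ → ℝ) (hf : ContDiff ℝ (⊤ : ℕ∞) (Function.uncurry f))
    (c : E2 → ℝ) (hc : ∀ x ∈ Ω, 0 ≤ c x)
    (u : E2 → ℝ → ℝ) (hureg : ContDiff ℝ (⊤ : ℕ∞) (Function.uncurry u))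
    (hu : IsDirectSolution Ω T k μ c f u)
    (hf0 : ∀ x ∈ Ω, f x 0 = 0)
    (hft : ∀ x ∈ Ω, ∀ t : ℝ, 0 ≤ t → t ≤ T → 0 < deriv (f x) t) :
    ∀ x ∈ Ω, ∀ t : ℝ, 0 < t → t ≤ T → 0 ≤ u x t := by
  have hfpos : ∀ x ∈ Ω, ∀ t : ℝ, 0 < t → t ≤ T → 0 < f x t := by
    intro x hx t h0 h1
    have hcf : Continuous (f x) := hf.continuous.comp (by fun_prop : Continuous fun t : ℝ => (x, t))
    have hm : StrictMonoOn (f x) (Set.Icc 0 T) := by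
      apply strictMonoOn_of_deriv_pos (convex_Icc 0 T) hcf.continuousOn
      intro s hs
      rw [interior_Icc] at hs
      exact hft x hx s hs.1.le hs.2.le
    have := hm ⟨le_refl _, hT.le⟩ ⟨h0.le, h1⟩ h0
    rwa [hf0 x hx] at this
  intro x hx t h0 h1
  obtain ⟨M, hM0, hM⟩ := aux_main Ω hΩo hΩb hΩconv T hT k μ k₁ k₂ hk₁ hkbd hkC1 hμ f c hc u hureg hu
    hfpos x hx
  by_contra hneg
  push Not at hneg
  have hC : 0 ≤ M * t := by positivity
  have := hM (-(u x t) / (2 * (M * t + 1))) (div_pos (by linarith) (by positivity)) x hx t h0.le h1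
  have e : (-(u x t) / (2 * (M * t + 1))) * (‖x - x‖ ^ 2 / 2 + M * t) ≤ -(u x t) / 2 := by
    rw [div_mul_eq_mul_div, div_le_div_iff₀ (by positivity) (by norm_num)]
    simp
    nlinarith
  linarith

end
end

section
/- Suppose u solves the direct problem with reaction coefficient c satisfying c(x) ≥ 0 for all x ∈ Ω, and f satisfies condition (7). Then the time derivative of the solution is nonnegative: ∂u/∂t(x,t) ≥ 0 for all x ∈ Ω and 0 < t ≤ T. -/
noncomputable section

lemma second_deriv_test {φ φ' : ℝ → ℝ} {φ'' : ℝ} (hmin : IsLocalMin φ 0)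
    (h1 : ∀ s, HasDerivAt φ (φ' s) s) (h2 : HasDerivAt φ' φ'' 0) :
    φ' 0 = 0 ∧ 0 ≤ φ'' := by
  have hd : deriv φ = φ' := funext fun s => (h1 s).deriv
  have h0 : φ' 0 = 0 := hmin.hasDerivAt_eq_zero (h1 0)
  refine ⟨h0, ?_⟩
  by_contra hneg
  push Not at hneg
  have hmax : IsLocalMax φ 0 := by
    apply isLocalMax_of_deriv_deriv_neg
    · rw [hd, h2.deriv]; exact hneg
    · rw [hd, h0]
    · exact (h1 0).continuousAt
  have hconst : φ =ᶠ[nhds 0] fun _ => φ 0 := by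
    filter_upwards [hmin, hmax] with s a b using le_antisymm b a
  have hd0 : φ' =ᶠ[nhds 0] fun _ => 0 := by
    have := hconst.deriv
    rw [hd] at this
    simpa using this
  have := hd0.deriv_eq
  rw [h2.deriv] at this
  simp at this
  linarith

lemma grad_coord (v : E2 → ℝ) (y : E2) (i : Fin 2) :
    gradient v y i = fderiv ℝ v y (EuclideanSpace.single i 1) := by
  rw [← toDual_gradient (𝕜 := ℝ), InnerProductSpace.toDual_apply_apply,
    EuclideanSpace.inner_single_right]
  simp

lemma ellOp_eq (k v : E2 → ℝ) (x : E2) (hk : DifferentiableAt ℝ k x) (hv : ContDiff ℝ 2 v) :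
    ellOp k v x = -∑ i : Fin 2, (fderiv ℝ k x (EuclideanSpace.single i 1) *
      fderiv ℝ v x (EuclideanSpace.single i 1) +
      k x * fderiv ℝ (fun y => fderiv ℝ v y (EuclideanSpace.single i 1)) x
        (EuclideanSpace.single i 1)) := by
  unfold ellOp
  congr 1
  refine Finset.sum_congr rfl fun i _ => ?_
  have hf : ContDiff ℝ 1 (fderiv ℝ v) := hv.fderiv_right (by norm_num)
  have hg : DifferentiableAt ℝ (gradient v) x := by
    have : gradient v = fun y => (InnerProductSpace.toDual ℝ E2).symm (fderiv ℝ v y) := rfl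
    rw [this]
    exact (InnerProductSpace.toDual ℝ E2).symm.toContinuousLinearEquiv.differentiableAt.comp x
      (hf.differentiable (by norm_num) x)
  have hs : DifferentiableAt ℝ (fun y => k y • gradient v y) x := hk.smul hg
  have h1 : fderiv ℝ (fun y => k y • gradient v y) x (EuclideanSpace.single i 1) i
      = fderiv ℝ (fun y => k y * fderiv ℝ v y (EuclideanSpace.single i 1)) x
        (EuclideanSpace.single i 1) := by
    have := ((EuclideanSpace.proj (𝕜 := ℝ) i).hasFDerivAt.comp x hs.hasFDerivAt).fderiv
    have e : (⇑(EuclideanSpace.proj (𝕜 := ℝ) i) ∘ fun y => k y • gradient v y)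
      = fun y => k y * fderiv ℝ v y (EuclideanSpace.single i 1) := by
      funext y
      simp [grad_coord]
    rw [e] at this
    rw [this]
    simp
  rw [h1]
  have hw : DifferentiableAt ℝ (fun y => fderiv ℝ v y (EuclideanSpace.single i 1)) x :=
    (hf.differentiable (by norm_num) x).clm_apply (differentiableAt_const _)
  rw [fderiv_fun_mul hk hw]
  simp
  ring

lemma ellOp_sub (k v w : E2 → ℝ) (x : E2) (hk : DifferentiableAt ℝ k x)
    (hv : ContDiff ℝ 2 v) (hw : ContDiff ℝ 2 w) :
    ellOp k (fun y => v y - w y) x = ellOp k v x - ellOp k w x := by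
  have hv' : ContDiff ℝ 1 (fderiv ℝ v) := hv.fderiv_right (by norm_num)
  have hw' : ContDiff ℝ 1 (fderiv ℝ w) := hw.fderiv_right (by norm_num)
  have e : ∀ y, fderiv ℝ (fun y => v y - w y) y = fderiv ℝ v y - fderiv ℝ w y := fun y =>
    fderiv_fun_sub (hv.differentiable (by norm_num) y) (hw.differentiable (by norm_num) y)
  rw [ellOp_eq k _ x hk (hv.sub hw), ellOp_eq k v x hk hv, ellOp_eq k w x hk hw, neg_sub_neg,
    ← neg_sub, neg_inj, ← Finset.sum_sub_distrib]
  refine Finset.sum_congr rfl fun i _ => ?_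
  simp only [e, ContinuousLinearMap.sub_apply]
  rw [fderiv_fun_sub ((hv'.differentiable (by norm_num) x).clm_apply (differentiableAt_const _))
    ((hw'.differentiable (by norm_num) x).clm_apply (differentiableAt_const _))]
  simp only [ContinuousLinearMap.sub_apply]
  ring

/-- At an interior minimum of `v + ε/2 |x-p|²`. -/
lemma interior_bound (v : E2 → ℝ) (hv : ContDiff ℝ 2 v) (p x : E2) (ε : ℝ)
    (hmin : IsLocalMin (fun y => v y + ε / 2 * ‖y - p‖ ^ 2) x) (i : Fin 2) :
    fderiv ℝ v x (EuclideanSpace.single i 1) = - ε * (x - p) i ∧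
    -ε ≤ fderiv ℝ (fun y => fderiv ℝ v y (EuclideanSpace.single i 1)) x
        (EuclideanSpace.single i 1) := by
  set e : E2 := EuclideanSpace.single i 1 with he
  have hv' : ContDiff ℝ 1 (fderiv ℝ v) := hv.fderiv_right (by norm_num)
  have hline : ∀ s : ℝ, HasDerivAt (fun s : ℝ => x + s • e) e s := fun s => by
    simpa using ((hasDerivAt_id s).smul_const e).const_add x
  have hn : ∀ s : ℝ, ‖x + s • e - p‖ ^ 2 = ‖x - p‖ ^ 2 + 2 * s * (x - p) i + s ^ 2 := by
    intro s
    have : x + s • e - p = (x - p) + s • e := by abel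
    rw [this, norm_add_sq_real, norm_smul, inner_smul_right, he,
      EuclideanSpace.inner_single_right]
    simp
    ring
  have hmin' : IsLocalMin (fun s : ℝ => v (x + s • e) +
      ε / 2 * (‖x - p‖ ^ 2 + 2 * s * (x - p) i + s ^ 2)) 0 := by
    have ht : Filter.Tendsto (fun s : ℝ => x + s • e) (nhds 0) (nhds x) := by
      have := (hline 0).continuousAt.tendsto
      simpa using this
    have := ht.eventually hmin
    filter_upwards [this] with s hs
    rw [← hn, ← hn]
    simpa using hs
  have key := second_deriv_test (φ' := fun s => fderiv ℝ v (x + s • e) e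
      + ε / 2 * (2 * (x - p) i + 2 * s))
      (φ'' := fderiv ℝ (fun y => fderiv ℝ v y e) x e + ε / 2 * 2) hmin' ?_ ?_
  · obtain ⟨h1, h2⟩ := key
    simp only [zero_smul, add_zero] at h1
    constructor <;> linarith
  · intro s
    have a := (hv.differentiable (by norm_num) (x + s • e)).hasFDerivAt.comp_hasDerivAt s (hline s)
    refine a.add (HasDerivAt.const_mul _ ?_)
    have b : HasDerivAt (fun s : ℝ => ‖x - p‖ ^ 2 + 2 * s * (x - p) i + s ^ 2)
      (0 + 2 * 1 * (x - p) i + 2 * s) s := by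
      refine ((hasDerivAt_const s _).add (((hasDerivAt_id s).const_mul 2).mul_const _)).add ?_
      simpa using hasDerivAt_pow 2 s
    simpa using b
  · have hd : DifferentiableAt ℝ (fun y => fderiv ℝ v y e) (x + (0 : ℝ) • e) :=
      ((hv'.differentiable (by norm_num) _).clm_apply (differentiableAt_const _))
    have a := hd.hasFDerivAt.comp_hasDerivAt 0 (hline 0)
    simp only [zero_smul, add_zero] at a
    refine a.add (HasDerivAt.const_mul _ ?_)
    simpa using ((hasDerivAt_id (0:ℝ)).const_mul 2).const_add (2 * (x - p) i)

/-- Boundary minimum is impossible. -/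
lemma boundary_contra (Ω : Set E2) (hΩo : IsOpen Ω) (hΩconv : Convex ℝ Ω)
    (v : E2 → ℝ) (x p : E2) (hv : DifferentiableAt ℝ v x) (hp : p ∈ Ω) (hx : x ∈ frontier Ω)
    (ε : ℝ) (hε : 0 < ε)
    (hmin : IsMinOn (fun y => v y + ε / 2 * ‖y - p‖ ^ 2) (closure Ω) x)
    (hrob : ∀ ν : E2, ‖ν‖ = 1 → (∀ y ∈ closure Ω, (inner ℝ ν (y - x) : ℝ) ≤ 0) →
      0 ≤ fderiv ℝ v x ν) : False := by
  set L : E2 →L[ℝ] ℝ := fderiv ℝ v x + (ε / 2) • (2 • (innerSL ℝ (x - p))) with hL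
  have hg : HasFDerivAt (fun y => v y + ε / 2 * ‖y - p‖ ^ 2) L x := by
    have h1 : HasFDerivAt (fun y : E2 => ‖y - p‖ ^ 2) (2 • (innerSL ℝ (x - p))) x := by
      have := ((hasFDerivAt_id x).sub_const p).norm_sq
      simpa using this
    exact hv.hasFDerivAt.add (h1.const_mul (ε / 2))
  have hLapp : ∀ ν, L ν = fderiv ℝ v x ν + ε * inner ℝ (x - p) ν := by
    intro ν
    simp only [hL, ContinuousLinearMap.add_apply, ContinuousLinearMap.smul_apply, smul_eq_mul,
      innerSL_apply_apply, nsmul_eq_mul, Nat.cast_ofNat]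
    ring
  have hpos : ∀ y ∈ closure Ω, 0 ≤ L (y - x) := by
    intro y hy
    refine (IsMinOn.localize hmin).hasFDerivWithinAt_nonneg hg.hasFDerivWithinAt ?_
    exact sub_mem_posTangentConeAt_of_segment_subset
      (hΩconv.closure.segment_subset (frontier_subset_closure hx) hy)
  -- any outward normal has L ν > 0
  have hout : ∀ ν : E2, ‖ν‖ = 1 → (∀ y ∈ closure Ω, (inner ℝ ν (y - x) : ℝ) ≤ 0) →
      0 < L ν := by
    intro ν hν hn
    have h0 := hrob ν hν hn
    obtain ⟨r, hr, hball⟩ := Metric.isOpen_iff.1 hΩo p hp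
    have hq : p + (r / 2) • ν ∈ Ω := hball (by
      simp [norm_smul, hν, abs_of_pos hr, hr])
    have h1 := hn _ (subset_closure hq)
    have h2 : (inner ℝ ν (p + (r / 2) • ν - x) : ℝ) = - inner ℝ (x - p) ν + r / 2 := by
      have : p + (r / 2) • ν - x = -(x - p) + (r / 2) • ν := by abel
      rw [this, inner_add_right, inner_neg_right, inner_smul_right, real_inner_self_eq_norm_sq, hν,
        real_inner_comm]
      ring
    rw [hLapp]
    have : 0 < (inner ℝ (x - p) ν : ℝ) := by linarith
    positivity
  set g : E2 := (InnerProductSpace.toDual ℝ E2).symm L with hgdef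
  have hgL : ∀ y, L y = inner ℝ g y := fun y => by
    rw [hgdef, InnerProductSpace.toDual_symm_apply]
  have hnormal : ∀ n : E2, n ≠ 0 → (∀ y ∈ Ω, (inner ℝ n (y - x) : ℝ) ≤ 0) → 0 < L n := by
    intro n hn h
    have hcl : ∀ y ∈ closure Ω, (inner ℝ n (y - x) : ℝ) ≤ 0 := by
      intro y hy
      have hc : IsClosed {y : E2 | (inner ℝ n (y - x) : ℝ) ≤ 0} :=
        isClosed_le (by fun_prop) continuous_const
      exact closure_minimal h hc hy
    have hnn : 0 < ‖n‖ := norm_pos_iff.2 hn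
    have := hout (‖n‖⁻¹ • n) (by rw [norm_smul]; simp [hnn.ne']) (fun y hy => by
      rw [inner_smul_left]
      exact mul_nonpos_of_nonneg_of_nonpos (by simp) (hcl y hy))
    rw [map_smul, smul_eq_mul] at this
    exact (pos_iff_pos_of_mul_pos this).1 (by positivity)
  by_cases hg0 : g = 0
  · have hxΩ : x ∉ Ω := by
      rw [hΩo.frontier_eq] at hx
      exact hx.2
    obtain ⟨F, hF⟩ := geometric_hahn_banach_open_point hΩconv hΩo hxΩ
    set n : E2 := (InnerProductSpace.toDual ℝ E2).symm F with hn
    have hnF : ∀ y, inner ℝ n y = F y := fun y => by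
      rw [hn, InnerProductSpace.toDual_symm_apply]
    have hn0 : n ≠ 0 := by
      intro h
      have := hF p hp
      rw [← hnF, ← hnF, h] at this
      simp at this
    have := hnormal n hn0 (fun y hy => by rw [hnF, map_sub]; linarith [hF y hy])
    rw [hgL, hg0] at this
    simp at this
  · have := hnormal (-g) (neg_ne_zero.2 hg0) (fun y hy => by
      rw [inner_neg_left, ← hgL]
      linarith [hpos y (subset_closure hy)])
    rw [hgL, inner_neg_right] at this
    linarith [real_inner_self_nonneg (x := g)]

lemma max_principle
    (Ω : Set E2) (hΩo : IsOpen Ω) (hΩb : Bornology.IsBounded Ω) (hΩconv : Convex ℝ Ω)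
    (k μ : E2 → ℝ) (k₁ k₂ : ℝ) (hk₁ : 0 < k₁)
    (hkbd : ∀ x ∈ closure Ω, k₁ ≤ k x ∧ k x ≤ k₂)
    (hkC1 : ContDiffOn ℝ 1 k (closure Ω))
    (hμ : ∀ x ∈ frontier Ω, 0 ≤ μ x)
    (c : E2 → ℝ) (hc : ∀ x ∈ Ω, 0 ≤ c x)
    (v : E2 → ℝ → ℝ) (hv : ContDiff ℝ 2 (Function.uncurry v)) (τ : ℝ)
    (hpde : ∀ x ∈ Ω, ∀ t : ℝ, 0 < t → t ≤ τ →
      0 ≤ deriv (v x) t + ellOp k (fun y => v y t) x + c x * v x t)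
    (hic : ∀ x ∈ Ω, 0 ≤ v x 0)
    (hrob : ∀ x ∈ frontier Ω, ∀ ν : E2, ‖ν‖ = 1 →
      (∀ y ∈ closure Ω, (inner ℝ ν (y - x) : ℝ) ≤ 0) →
      ∀ t : ℝ, 0 < t → t ≤ τ →
        k x * fderiv ℝ (fun y => v y t) x ν + μ x * v x t = 0) :
    ∀ x ∈ Ω, ∀ t : ℝ, 0 ≤ t → t ≤ τ → 0 ≤ v x t := by
  intro p hp t₁ ht₁ ht₁τ
  by_contra hneg
  push Not at hneg
  have hcpt : IsCompact (closure Ω) := hΩb.isCompact_closure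
  have hvx : ∀ t, ContDiff ℝ 2 (fun y => v y t) := fun t =>
    hv.comp (contDiff_id.prodMk contDiff_const)
  have hvt : ∀ x, ContDiff ℝ 2 (v x) := fun x =>
    hv.comp (contDiff_const.prodMk contDiff_id)
  have hvc : Continuous (Function.uncurry v) := hv.continuous
  have hk2 : 0 < k₂ := lt_of_lt_of_le hk₁
    ((hkbd p (subset_closure hp)).1.trans (hkbd p (subset_closure hp)).2)
  -- bound on the gradient of k
  obtain ⟨D, hD⟩ : ∃ D, ∀ x ∈ Ω, ‖fderiv ℝ k x‖ ≤ D := by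
    have hu : UniqueDiffOn ℝ (closure Ω) := uniqueDiffOn_convex hΩconv.closure
      ⟨p, interior_mono subset_closure (hΩo.interior_eq.symm ▸ hp)⟩
    obtain ⟨D, hD⟩ := hcpt.exists_bound_of_continuousOn
      (hkC1.continuousOn_fderivWithin hu le_rfl)
    refine ⟨D, fun x hx => ?_⟩
    rw [← fderivWithin_of_mem_nhds (Filter.mem_of_superset (hΩo.mem_nhds hx) subset_closure)]
    exact hD x (subset_closure hx)
  have hD0 : 0 ≤ D := (norm_nonneg _).trans (hD p hp)
  obtain ⟨R, hR⟩ := hΩb.subset_closedBall p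
  have hR0 : 0 ≤ R := by simpa using hR hp
  have hkd : ∀ x ∈ Ω, DifferentiableAt ℝ k x := fun x hx =>
    (hkC1.contDiffAt (Filter.mem_of_superset (hΩo.mem_nhds hx) subset_closure)).differentiableAt
      (by norm_num)
  set C : ℝ := 2 * k₂ + 2 * (D * R) + 1 with hC
  have hC0 : 0 < C := by positivity
  set ε : ℝ := -v p t₁ / (C * t₁ + 1) with hεdef
  have hden : 0 < C * t₁ + 1 := by positivity
  have hε : 0 < ε := div_pos (by linarith) hden
  have hεeq : ε * (C * t₁ + 1) = -v p t₁ := div_mul_cancel₀ _ hden.ne'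
  let w : E2 × ℝ → ℝ := fun z => v z.1 z.2 + ε / 2 * ‖z.1 - p‖ ^ 2 + ε * C * z.2
  have hwc : Continuous w := by
    have : Continuous (fun z : E2 × ℝ => v z.1 z.2) := hvc
    fun_prop
  have hτ : 0 ≤ τ := ht₁.trans ht₁τ
  obtain ⟨⟨x₀, t₀⟩, ⟨hx₀, ht₀⟩, hmin⟩ := (hcpt.prod (isCompact_Icc (a := 0) (b := τ))).exists_isMinOn
    ⟨(p, t₁), subset_closure hp, ht₁, ht₁τ⟩ hwc.continuousOn
  simp only at hx₀ ht₀
  have hw0 : w (x₀, t₀) < 0 := by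
    refine lt_of_le_of_lt (hmin (show (p, t₁) ∈ _ from ⟨subset_closure hp, ht₁, ht₁τ⟩)) ?_
    simp only [w, sub_self, norm_zero]
    nlinarith
  have hvw : v x₀ t₀ < 0 := by
    have : 0 ≤ ε / 2 * ‖x₀ - p‖ ^ 2 := by positivity
    have h2 : 0 ≤ ε * C * t₀ := mul_nonneg (by positivity) ht₀.1
    simp only [w] at hw0
    linarith
  have ht0pos : 0 < t₀ := by
    rcases ht₀.1.lt_or_eq with h | h
    · exact h
    · exfalso
      have hcl : IsClosed {y : E2 | 0 ≤ v y 0} :=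
        isClosed_le continuous_const (hvx 0).continuous
      have : 0 ≤ v x₀ 0 := closure_minimal hic hcl hx₀
      rw [← h] at hvw
      linarith
  have hminx : IsMinOn (fun y => v y t₀ + ε / 2 * ‖y - p‖ ^ 2) (closure Ω) x₀ := by
    intro y hy
    have := hmin (show (y, t₀) ∈ _ from ⟨hy, ht₀⟩)
    simp only [w, Set.mem_setOf_eq] at this ⊢
    linarith
  by_cases hxΩ : x₀ ∈ Ω
  · have hloc : IsLocalMin (fun y => v y t₀ + ε / 2 * ‖y - p‖ ^ 2) x₀ :=
      hminx.isLocalMin (Filter.mem_of_superset (hΩo.mem_nhds hxΩ) subset_closure)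
    have hib := interior_bound _ (hvx t₀) p x₀ ε hloc
    have hmint : IsMinOn (fun t => v x₀ t + ε * C * t) (Set.Icc 0 τ) t₀ := by
      intro t ht
      have := hmin (show (x₀, t) ∈ _ from ⟨hx₀, ht⟩)
      simp only [w, Set.mem_setOf_eq] at this ⊢
      linarith
    have hdt : deriv (v x₀) t₀ ≤ -(ε * C) := by
      have h1 : HasDerivAt (fun t => v x₀ t + ε * C * t) (deriv (v x₀) t₀ + ε * C * 1) t₀ :=
        (((hvt x₀).differentiable (by norm_num) t₀).hasDerivAt).add
          ((hasDerivAt_id t₀).const_mul (ε * C))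
      have h2 := (IsMinOn.localize hmint).hasFDerivWithinAt_nonneg
        h1.hasFDerivAt.hasFDerivWithinAt
        (sub_mem_posTangentConeAt_of_segment_subset (y := 0)
          ((convex_Icc 0 τ).segment_subset ht₀ ⟨le_rfl, hτ⟩))
      simp at h2
      nlinarith
    have hkb := hkbd x₀ hx₀
    have hcomp : ∀ i : Fin 2, -(ε * (D * R + k₂)) ≤
        fderiv ℝ k x₀ (EuclideanSpace.single i 1) *
        fderiv ℝ (fun y => v y t₀) x₀ (EuclideanSpace.single i 1) +
        k x₀ * fderiv ℝ (fun y => fderiv ℝ (fun y => v y t₀) y (EuclideanSpace.single i 1)) x₀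
        (EuclideanSpace.single i 1) := by
      intro i
      obtain ⟨h1, h2⟩ := hib i
      rw [h1]
      have a1 : |fderiv ℝ k x₀ (EuclideanSpace.single i 1)| ≤ D := by
        have := (fderiv ℝ k x₀).le_opNorm (EuclideanSpace.single i 1)
        simp only [PiLp.norm_single, norm_one, mul_one, Real.norm_eq_abs] at this
        exact this.trans (hD x₀ hxΩ)
      have a2 : |(x₀ - p) i| ≤ R := by
        have h := PiLp.norm_apply_le (x₀ - p) i
        have h' := hR hxΩ
        rw [Metric.mem_closedBall, dist_eq_norm] at h'
        exact h.trans h'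
      have a3 : |fderiv ℝ k x₀ (EuclideanSpace.single i 1) * (x₀ - p) i| ≤ D * R := by
        rw [abs_mul]
        exact mul_le_mul a1 a2 (abs_nonneg _) hD0
      have a4 := (abs_le.1 a3).2
      have a5 : -(ε * k₂) ≤ k x₀ * fderiv ℝ
          (fun y => fderiv ℝ (fun y => v y t₀) y (EuclideanSpace.single i 1)) x₀
          (EuclideanSpace.single i 1) := by
        have : k x₀ * (-ε) ≤ k x₀ * fderiv ℝ
          (fun y => fderiv ℝ (fun y => v y t₀) y (EuclideanSpace.single i 1)) x₀
          (EuclideanSpace.single i 1) := mul_le_mul_of_nonneg_left h2 (by linarith)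
        nlinarith
      have a6 := mul_le_mul_of_nonneg_left a4 hε.le
      nlinarith
    have hp0 := hpde x₀ hxΩ t₀ ht0pos ht₀.2
    rw [ellOp_eq k _ x₀ (hkd x₀ hxΩ) (hvx t₀), Fin.sum_univ_two] at hp0
    have b0 := hcomp 0
    have b1 := hcomp 1
    have hcv : c x₀ * v x₀ t₀ ≤ 0 := mul_nonpos_of_nonneg_of_nonpos (hc x₀ hxΩ) hvw.le
    have : ε * C = 2 * (ε * (D * R + k₂)) + ε := by rw [hC]; ring
    linarith
  · have hxf : x₀ ∈ frontier Ω := by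
      rw [hΩo.frontier_eq]
      exact ⟨hx₀, hxΩ⟩
    refine boundary_contra Ω hΩo hΩconv (fun y => v y t₀) x₀ p
      ((hvx t₀).differentiable (by norm_num) x₀) hp hxf ε hε hminx ?_
    intro ν hν hn
    have h := hrob x₀ hxf ν hν hn t₀ ht0pos ht₀.2
    have h1 : μ x₀ * v x₀ t₀ ≤ 0 := mul_nonpos_of_nonneg_of_nonpos (hμ x₀ hxf) hvw.le
    have hk0 : 0 < k x₀ := lt_of_lt_of_le hk₁ (hkbd x₀ hx₀).1
    by_contra hlt
    push Not at hlt
    have := mul_neg_of_pos_of_neg hk0 hlt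
    linarith

/-- the time derivative of the solution of the direct problem with
nonnegative reaction coefficient and right-hand side satisfying condition (7)
is nonnegative. -/
theorem time_deriv_nonneg
    (Ω : Set E2) (hΩo : IsOpen Ω) (hΩb : Bornology.IsBounded Ω) (hΩconv : Convex ℝ Ω)
    (T : ℝ) (hT : 0 < T)
    (k μ : E2 → ℝ) (k₁ k₂ : ℝ) (hk₁ : 0 < k₁)
    (hkbd : ∀ x ∈ closure Ω, k₁ ≤ k x ∧ k x ≤ k₂)
    (hkC1 : ContDiffOn ℝ 1 k (closure Ω))
    (hμ : ∀ x ∈ frontier Ω, 0 ≤ μ x)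
    (f : E2 → ℝ → ℝ) (hf : ContDiff ℝ (⊤ : ℕ∞) (Function.uncurry f))
    (c : E2 → ℝ) (hc : ∀ x ∈ Ω, 0 ≤ c x)
    (u : E2 → ℝ → ℝ) (hureg : ContDiff ℝ (⊤ : ℕ∞) (Function.uncurry u))
    (hu : IsDirectSolution Ω T k μ c f u)
    (hf0 : ∀ x ∈ Ω, f x 0 = 0)
    (hft : ∀ x ∈ Ω, ∀ t : ℝ, 0 ≤ t → t ≤ T → 0 < deriv (f x) t) :
    ∀ x ∈ Ω, ∀ t : ℝ, 0 < t → t ≤ T → 0 ≤ deriv (u x) t := by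
  have hu2 : ContDiff ℝ 2 (Function.uncurry u) := (contDiff_infty.1 hureg) 2
  have hux : ∀ t, ContDiff ℝ 2 (fun y => u y t) := fun t =>
    hu2.comp (contDiff_id.prodMk contDiff_const)
  have hut : ∀ x, ContDiff ℝ 2 (u x) := fun x =>
    hu2.comp (contDiff_const.prodMk contDiff_id)
  have hkd : ∀ x ∈ Ω, DifferentiableAt ℝ k x := fun x hx =>
    (hkC1.contDiffAt (Filter.mem_of_superset (hΩo.mem_nhds hx) subset_closure)).differentiableAt
      (by norm_num)
  have hfmono : ∀ x ∈ Ω, MonotoneOn (f x) (Set.Icc 0 T) := by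
    intro x hx
    have hfx : ContDiff ℝ (⊤ : ℕ∞) (f x) := hf.comp (contDiff_const.prodMk contDiff_id)
    refine (strictMonoOn_of_deriv_pos (convex_Icc 0 T) hfx.continuous.continuousOn ?_).monotoneOn
    intro t ht
    rw [interior_Icc] at ht
    exact hft x hx t ht.1.le ht.2.le
  have hupos : ∀ x ∈ Ω, ∀ t : ℝ, 0 ≤ t → t ≤ T → 0 ≤ u x t := by
    refine max_principle Ω hΩo hΩb hΩconv k μ k₁ k₂ hk₁ hkbd hkC1 hμ c hc u hu2 T ?_ ?_ hu.robin
    · intro x hx t h0 h1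
      rw [hu.pde x hx t h0 h1, ← hf0 x hx]
      exact hfmono x hx ⟨le_rfl, hT.le⟩ ⟨h0.le, h1⟩ h0.le
    · intro x hx
      rw [hu.ic x hx]
  have hmono : ∀ x ∈ Ω, ∀ h : ℝ, 0 ≤ h → h ≤ T → ∀ t : ℝ, 0 ≤ t → t ≤ T - h →
      0 ≤ u x (t + h) - u x t := by
    intro x hx h hh hhT
    refine max_principle Ω hΩo hΩb hΩconv k μ k₁ k₂ hk₁ hkbd hkC1 hμ c hc
      (fun x t => u x (t + h) - u x t) ?_ (T - h) ?_ ?_ ?_ x hx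
    · have h1 : ContDiff ℝ 2 (fun z : E2 × ℝ => (z.1, z.2 + h)) :=
        contDiff_fst.prodMk (contDiff_snd.add contDiff_const)
      exact (hu2.comp h1).sub hu2
    · intro x hx t h0 h1
      have e1 := hu.pde x hx t h0 (by linarith)
      have e2 := hu.pde x hx (t + h) (by linarith) (by linarith)
      have ed : deriv (fun t => u x (t + h) - u x t) t = deriv (u x) (t + h) - deriv (u x) t := by
        have a1 := ((hut x).differentiable (by norm_num) (t + h)).hasDerivAt.comp_add_const t h
        exact (a1.sub ((hut x).differentiable (by norm_num) t).hasDerivAt).deriv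
      have ee := ellOp_sub k _ _ x (hkd x hx) (hux (t + h)) (hux t)
      have hfm := hfmono x hx (a := t) (b := t + h) ⟨h0.le, by linarith⟩
        ⟨by linarith, by linarith⟩ (by linarith)
      simp only [ed, ee]
      linarith
    · intro x hx
      simp only [zero_add, hu.ic x hx, sub_zero]
      exact hupos x hx h hh hhT
    · intro x hx ν hν hn t h0 h1
      have e1 := hu.robin x hx ν hν hn t h0 (by linarith)
      have e2 := hu.robin x hx ν hν hn (t + h) (by linarith) (by linarith)
      rw [fderiv_fun_sub ((hux (t + h)).differentiable (by norm_num) x)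
        ((hux t).differentiable (by norm_num) x), ContinuousLinearMap.sub_apply]
      linarith
  intro x hx t h0 h1
  have hm : MonotoneOn (u x) (Set.Icc 0 T) := by
    intro a ha b hb hab
    have := hmono x hx (b - a) (by linarith) (by linarith [ha.1, hb.2]) a ha.1 (by linarith [hb.2])
    rw [add_sub_cancel] at this
    linarith
  have hd := (hut x).differentiable (by norm_num) t
  rw [← hd.derivWithin (uniqueDiffOn_Icc hT t ⟨h0.le, h1⟩)]
  exact hm.derivWithin_nonneg

end
end
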